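/- Exact multiplication of a constrained matrix zonotope with a constrained polynomial zonotope having fresh (disjoint) factor identifiers yields a constrained polynomial zonotope (corollary to the exact multiplication proposition, as used in the reachability time update). Let 𝓝 = CMZ(C, G_N, A_N, B_N) ⊆ Matrix (Fin nx) (Fin n) ℝ with γ generators and constraints of size nc × na, and let 𝒫 = CPZ(c, G_P, E_P, A_P, b_P, R_P) ⊆ (Fin n → ℝ) with h generators, p factors, and q constraint generators. Then the set of all (C + ∑ i : Fin γ, (α (Sum.inl i)) • G_N i).mulVec (c + ∑ j : Fin h, (∏ k : Fin p, (α (Sum.inr k))^(E_P k j)) • (fun r => G_P r j)) over all α : (Fin γ ⊕ Fin p) → ℝ with α k ∈ Set.Icc (-1) 1 for all k satisfying ∑ i, (α (Sum.inl i)) • A_N i = B_N and ∑ j, (∏ k, (α (Sum.inr k))^(R_P k j)) • (fun r => A_P r j) = b_P, equals the set of all x : Fin nx → ℝ for which there exists such an α with x = C.mulVec c + ∑ i : Fin γ, (α (Sum.inl i)) • (G_N i).mulVec c + ∑ j : Fin h, (∏ k, (α (Sum.inr k))^(E_P k j)) • C.mulVec (fun r => G_P r j) + ∑ i : Fin γ,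 ∑ j : Fin h, (α (Sum.inl i) * ∏ k, (α (Sum.inr k))^(E_P k j)) • (G_N i).mulVec (fun r => G_P r j), together with the constraints ∑ i, (α (Sum.inl i)) • vec(A_N i) = vec(B_N) and ∑ j, (∏ k, (α (Sum.inr k))^(R_P k j)) • (fun r => A_P r j) = b_P. -/

import Mathlib

open Matrix BigOperators

/-- Vectorization of a matrix. -/
def vecM {a b : ℕ} (M : Matrix (Fin a) (Fin b) ℝ) : Fin a × Fin b → ℝ :=
  fun ij => M ij.1 ij.2

theorem vecM_injective {a b : ℕ} :
    Function.Injective (vecM : Matrix (Fin a) (Fin b) ℝ → Fin a × Fin b → ℝ) :=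
  fun _ _ h => Matrix.ext fun i j => congrFun h (i, j)

theorem vecM_sum_smul {ι : Type*} [Fintype ι] {a b : ℕ} (r : ι → ℝ)
    (M : ι → Matrix (Fin a) (Fin b) ℝ) :
    vecM (∑ i, r i • M i) = ∑ i, r i • vecM (M i) := by
  ext ij
  simp [vecM, Matrix.sum_apply]

theorem add_sum_smul_mulVec_add_sum_smul {R ι κ m n : Type*} [CommRing R] [Fintype ι] [Fintype κ]
    [Fintype n] (C : Matrix m n R) (G : ι → Matrix m n R) (c : n → R) (v : κ → n → R)
    (s : ι → R) (t : κ → R) :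
    (C + ∑ i, s i • G i) *ᵥ (c + ∑ j, t j • v j) =
      C *ᵥ c + ∑ i, s i • G i *ᵥ c + ∑ j, t j • C *ᵥ v j
        + ∑ i, ∑ j, (s i * t j) • G i *ᵥ v j := by
  simp only [Matrix.add_mulVec, Matrix.mulVec_add, Matrix.sum_mulVec, Matrix.mulVec_sum,
    Matrix.smul_mulVec, Matrix.mulVec_smul, Finset.smul_sum, Finset.sum_add_distrib, smul_add,
    smul_smul]
  rw [Finset.sum_comm (γ := ι)]
  simp only [mul_comm (t _)]
  abel

/-- Exact multiplication of a constrained matrix zonotope with a constrained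
polynomial zonotope having fresh (disjoint) factor identifiers yields a
constrained polynomial zonotope. -/
theorem cmz_cpz_exact_mult {nx n γ p h nc na mP q : ℕ}
    (C : Matrix (Fin nx) (Fin n) ℝ) (GN : Fin γ → Matrix (Fin nx) (Fin n) ℝ)
    (AN : Fin γ → Matrix (Fin nc) (Fin na) ℝ) (BN : Matrix (Fin nc) (Fin na) ℝ)
    (c : Fin n → ℝ) (GP : Matrix (Fin n) (Fin h) ℝ) (EP : Matrix (Fin p) (Fin h) ℕ)
    (AP : Matrix (Fin mP) (Fin q) ℝ) (bP : Fin mP → ℝ) (RP : Matrix (Fin p) (Fin q) ℕ) :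
    {x : Fin nx → ℝ | ∃ α : (Fin γ ⊕ Fin p) → ℝ,
        (∀ k, α k ∈ Set.Icc (-1 : ℝ) 1) ∧
        (∑ i, (α (Sum.inl i)) • AN i = BN) ∧
        (∑ j, (∏ k, (α (Sum.inr k)) ^ (RP k j)) • (fun r => AP r j) = bP) ∧
        x = (C + ∑ i, (α (Sum.inl i)) • GN i).mulVec
              (c + ∑ j, (∏ k, (α (Sum.inr k)) ^ (EP k j)) • (fun r => GP r j))} =
    {x : Fin nx → ℝ | ∃ α : (Fin γ ⊕ Fin p) → ℝ,
        (∀ k, α k ∈ Set.Icc (-1 : ℝ) 1) ∧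
        x = C.mulVec c + ∑ i, (α (Sum.inl i)) • (GN i).mulVec c
            + ∑ j, (∏ k, (α (Sum.inr k)) ^ (EP k j)) • C.mulVec (fun r => GP r j)
            + ∑ i, ∑ j, (α (Sum.inl i) * ∏ k, (α (Sum.inr k)) ^ (EP k j)) •
                (GN i).mulVec (fun r => GP r j) ∧
        (∑ i, (α (Sum.inl i)) • vecM (AN i) = vecM BN) ∧
        (∑ j, (∏ k, (α (Sum.inr k)) ^ (RP k j)) • (fun r => AP r j) = bP)} := by
  ext x
  simp only [Set.mem_ofPred_eq, ← vecM_sum_smul, vecM_injective.eq_iff,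
    add_sum_smul_mulVec_add_sum_smul]
  exact exists_congr fun α => by tauto
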